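/- Let ε₁, ε₂ be real numbers with 0 < ε₁ < 1, 0 < ε₂ < 1, and ε₂ ≥ 1 − (1 − ε₁)ε₁/2. Define the region C ⊆ ℝ² as the set of pairs (R₁, R₂) such that for every pair of permutations (π¹, π²) of {1, 2} there exist nonnegative reals R_{11}, R_{12}, R_{21}, R_{22} with R₁ = R_{11} + R_{21}, R₂ = R_{12} + R_{22}, R_{1π¹(1)}/(1 − ε₁) + R_{1π¹(2)}/(1 − ε₁²) ≤ 1, and R_{2π²(1)}/(1 − ε₂) + R_{2π²(2)}/(1 − ε₂) ≤ 1. Then max_{(R₁,R₂) ∈ C} (R₁ + R₂) = 2(2 − ε₁² + ε₁ − ε₂ − ε₁ε₂)/(2 + ε₁). -/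

import Mathlib

lemma perm_fin_two_cases (π : Equiv.Perm (Fin 2)) :
    (π 0 = 0 ∧ π 1 = 1) ∨ (π 0 = 1 ∧ π 1 = 0) := by
  revert π
  decide

lemma subchannel_one_iff (e x y : ℝ) (h : 0 < e) (h' : e < 1) :
    x / (1 - e) + y / (1 - e ^ 2) ≤ 1 ↔ (1 + e) * x + y ≤ 1 - e ^ 2 := by
  have ha : 0 < 1 - e := by linarith
  have hb : 0 < 1 - e ^ 2 := by nlinarith
  have key : x / (1 - e) + y / (1 - e ^ 2) = ((1 + e) * x + y) / (1 - e ^ 2) := by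
    have : 1 - e ^ 2 = (1 - e) * (1 + e) := by ring
    have hc : 1 + e ≠ 0 := by linarith
    rw [this]
    field_simp
  rw [key, div_le_one hb]

lemma subchannel_two_iff (e x y : ℝ) (h' : e < 1) :
    x / (1 - e) + y / (1 - e) ≤ 1 ↔ x + y ≤ 1 - e := by
  have ha : 0 < 1 - e := by linarith
  rw [← add_div, div_le_one ha]

/-- The maximum sum rate of the outer bound region of the two-input 1-to-2
broadcast packet erasure channel with feedback (subchannel 1 with independent
erasures of probability ε₁, subchannel 2 with fully correlated erasures of
probability ε₂) equals `2 (2 - ε₁² + ε₁ - ε₂ - ε₁ ε₂) / (2 + ε₁)` whenever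
`ε₂ ≥ 1 - (1 - ε₁) ε₁ / 2`. -/
theorem outer_bound_max_sum_rate (ε₁ ε₂ : ℝ) (h₁ : 0 < ε₁) (h₁' : ε₁ < 1)
    (h₂ : 0 < ε₂) (h₂' : ε₂ < 1) (hc : 1 - (1 - ε₁) * ε₁ / 2 ≤ ε₂) :
    IsGreatest {x : ℝ | ∃ p : ℝ × ℝ,
      (∀ π₁ π₂ : Equiv.Perm (Fin 2), ∃ R : Fin 2 → Fin 2 → ℝ,
        (∀ m k, 0 ≤ R m k) ∧
        p.1 = R 0 0 + R 1 0 ∧ p.2 = R 0 1 + R 1 1 ∧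
        R 0 (π₁ 0) / (1 - ε₁) + R 0 (π₁ 1) / (1 - ε₁ ^ 2) ≤ 1 ∧
        R 1 (π₂ 0) / (1 - ε₂) + R 1 (π₂ 1) / (1 - ε₂) ≤ 1) ∧
      x = p.1 + p.2}
      (2 * (2 - ε₁ ^ 2 + ε₁ - ε₂ - ε₁ * ε₂) / (2 + ε₁)) := by
  simp only [subchannel_one_iff _ _ _ h₁ h₁', subchannel_two_iff _ _ _ h₂']
  have hpos : 0 < 2 + ε₁ := by linarith
  constructor
  · obtain ⟨r, hr⟩ : ∃ r, r = (2 - ε₁ ^ 2 + ε₁ - ε₂ - ε₁ * ε₂) / (2 + ε₁) := ⟨_, rfl⟩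
    have hr' : r * (2 + ε₁) = 2 - ε₁ ^ 2 + ε₁ - ε₂ - ε₁ * ε₂ := by
      rw [hr]; field_simp
    have hrd : 1 - ε₂ ≤ r := by
      rw [hr, le_div_iff₀ hpos]; nlinarith
    have hr0 : 0 ≤ r := by linarith
    refine ⟨(r, r), ?_, ?_⟩
    · intro π₁ π₂
      rcases perm_fin_two_cases π₁ with ⟨a, b⟩ | ⟨a, b⟩ <;>
      rcases perm_fin_two_cases π₂ with ⟨c, d⟩ | ⟨c, d⟩ <;>
      simp only [a, b, c, d]
      · refine ⟨![![r - (1 - ε₂), r], ![1 - ε₂, 0]], ?_, ?_⟩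
        · simp [Fin.forall_fin_two]; grind
        · simp; linarith
      · refine ⟨![![r - (1 - ε₂), r], ![1 - ε₂, 0]], ?_, ?_⟩
        · simp [Fin.forall_fin_two]; grind
        · simp; linarith
      · refine ⟨![![r, r - (1 - ε₂)], ![0, 1 - ε₂]], ?_, ?_⟩
        · simp [Fin.forall_fin_two]; grind
        · simp; linarith
      · refine ⟨![![r, r - (1 - ε₂)], ![0, 1 - ε₂]], ?_, ?_⟩
        · simp [Fin.forall_fin_two]; grind
        · simp; linarith
    · rw [hr]; ring
  · rintro x ⟨p, hp, rfl⟩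
    obtain ⟨R, hR, h1, h2, h3, h4⟩ := hp 1 1
    obtain ⟨S, hS, k1, k2, k3, k4⟩ := hp (Equiv.swap 0 1) 1
    simp at h3 h4 k3 k4
    rw [le_div_iff₀ hpos]
    have hA : (1 + ε₁) * p.1 + p.2 ≤ 1 - ε₁ ^ 2 + (1 + ε₁) * (1 - ε₂) := by
      rw [h1, h2]
      nlinarith [mul_nonneg h₁.le (hR 1 1), mul_nonneg h₁.le (sub_nonneg.2 h4)]
    have hB : (1 + ε₁) * p.2 + p.1 ≤ 1 - ε₁ ^ 2 + (1 + ε₁) * (1 - ε₂) := by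
      rw [k1, k2]
      nlinarith [mul_nonneg h₁.le (hS 1 0), mul_nonneg h₁.le (sub_nonneg.2 k4)]
    nlinarith
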